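/- For every ρ ≥ 1 there exists a constant C depending only on ρ such that the following holds. Let T ⊂ ℝ³ be a nondegenerate tetrahedron with vertices p₀, p₁, p₂, p₃, diameter h and inradius r satisfying h/r ≤ ρ. For each i let σᵢ be an edge of T having pᵢ as an endpoint, and define the quasi-interpolant Du = Σᵢ (Π_{σᵢ}u)(pᵢ) λᵢ, where λᵢ are the barycentric coordinates of T. Then for every u twice continuously differentiable on a neighborhood of the closure of T: |u − Du|_{H¹(T)} ≤ C h |u|_{H²(T)}. -/

import Mathlib

open MeasureTheory Set

noncomputable section

/-- The inradius of a set `T ⊆ ℝ³`: the supremum of radii of closed balls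
contained in `T`. -/
def inradius (T : Set (EuclideanSpace ℝ (Fin 3))) : ℝ :=
  sSup {s : ℝ | ∃ c, Metric.closedBall c s ⊆ T}

/-- The `H¹(T)` seminorm `|u|_{H¹(T)} = (Σ_{|α|=1} ∫_T |∂^α u|²)^{1/2}`. -/
def H1seminorm (T : Set (EuclideanSpace ℝ (Fin 3)))
    (u : EuclideanSpace ℝ (Fin 3) → ℝ) : ℝ :=
  Real.sqrt (∑ i : Fin 3, ∫ x in T, (fderiv ℝ u x (EuclideanSpace.single i 1)) ^ 2)

/-- The `H²(T)` seminorm `|u|_{H²(T)} = (Σ_{|α|=2} ∫_T |∂^α u|²)^{1/2}`. -/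
def H2seminorm (T : Set (EuclideanSpace ℝ (Fin 3)))
    (u : EuclideanSpace ℝ (Fin 3) → ℝ) : ℝ :=
  Real.sqrt (∑ i : Fin 3, ∑ j : Fin 3, ∫ x in T,
    (iteratedFDeriv ℝ 2 u x
      ![EuclideanSpace.single i 1, EuclideanSpace.single j 1]) ^ 2)

section Analysis

/-- Integrability of a continuous function on a product of compact sets. -/
theorem integrable_prod_of_continuousOn {E : Type*} [TopologicalSpace E] [T2Space E]
    [MeasurableSpace E] [BorelSpace E] [SecondCountableTopology E]
    {μ : Measure E} [IsFiniteMeasureOnCompacts μ] [SFinite μ]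
    {T : Set E} (hT : IsCompact T) {f : E × ℝ → ℝ}
    (hf : ContinuousOn f (T ×ˢ Icc 0 1)) :
    Integrable f ((μ.restrict T).prod (volume.restrict (Icc (0 : ℝ) 1))) := by
  rw [Measure.prod_restrict]
  refine hf.integrableOn_of_subset_isCompact (hT.prod isCompact_Icc)
    (hT.prod isCompact_Icc).measurableSet subset_rfl ?_
  rw [Measure.prod_prod]
  exact (ENNReal.mul_lt_top hT.measure_lt_top isCompact_Icc.measure_lt_top).ne

variable {E : Type*} [NormedAddCommGroup E] [NormedSpace ℝ E]

/-- The Cauchy–Schwarz inequality against the constant function on the unit interval. -/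
theorem sq_integral_Icc_le {f : ℝ → ℝ} (hf : ContinuousOn f (Icc 0 1)) :
    (∫ t in Icc (0 : ℝ) 1, f t) ^ 2 ≤ ∫ t in Icc (0 : ℝ) 1, f t ^ 2 := by
  set m := ∫ t in Icc (0 : ℝ) 1, f t with hm
  have hfi : IntegrableOn f (Icc 0 1) := hf.integrableOn_compact isCompact_Icc
  have hfi2 : IntegrableOn (fun t => f t ^ 2) (Icc 0 1) :=
    (hf.pow 2).integrableOn_compact isCompact_Icc
  have hnonneg : 0 ≤ ∫ t in Icc (0 : ℝ) 1, (f t - m) ^ 2 :=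
    integral_nonneg fun t => sq_nonneg _
  have hexpand : ∫ t in Icc (0 : ℝ) 1, (f t - m) ^ 2
      = (∫ t in Icc (0 : ℝ) 1, f t ^ 2) - 2 * m * m + m ^ 2 := by
    have : ∀ t, (f t - m) ^ 2 = f t ^ 2 - 2 * m * f t + m ^ 2 := fun t => by ring
    simp_rw [this]
    have h1 : IntegrableOn (fun t => 2 * m * f t) (Icc 0 1) := hfi.const_mul _
    have h12 : IntegrableOn (fun t => f t ^ 2 - 2 * m * f t) (Icc 0 1) := hfi2.sub h1
    have h2 : IntegrableOn (fun _ : ℝ => m ^ 2) (Icc 0 1) :=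
      continuousOn_const.integrableOn_compact isCompact_Icc
    rw [integral_add h12 h2,
      integral_sub hfi2 h1, integral_const_mul]
    simp [← hm]
  nlinarith

/-- The value at an endpoint of an affine function on the unit interval is controlled by its
`L²` distance to any function it approximates at least as well as zero does. -/
theorem sq_le_of_affine_approx {v : ℝ → ℝ} (hv : ContinuousOn v (Icc 0 1)) (a b : ℝ)
    (h : ∫ t in Icc (0 : ℝ) 1, (v t - (a + b * t)) ^ 2 ≤ ∫ t in Icc (0 : ℝ) 1, v t ^ 2) :
    a ^ 2 ≤ 16 * ∫ t in Icc (0 : ℝ) 1, v t ^ 2 := by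
  have hi : ∀ {f : ℝ → ℝ}, ContinuousOn f (Icc 0 1) → IntegrableOn f (Icc 0 1) :=
    fun hf => hf.integrableOn_compact isCompact_Icc
  have hle : ∫ t in Icc (0 : ℝ) 1, (a + b * t) ^ 2
      ≤ ∫ t in Icc (0 : ℝ) 1, (2 * (v t - (a + b * t)) ^ 2 + 2 * v t ^ 2) := by
    refine integral_mono (hi (by fun_prop)) (hi (by fun_prop)) fun t => ?_
    nlinarith [sq_nonneg (2 * v t - (a + b * t))]
  rw [integral_add (hi (by fun_prop)) (hi (by fun_prop)), integral_const_mul,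
    integral_const_mul] at hle
  have heval : ∫ t in Icc (0 : ℝ) 1, (a + b * t) ^ 2 = a ^ 2 + a * b + b ^ 2 / 3 := by
    rw [integral_Icc_eq_integral_Ioc, ← intervalIntegral.integral_of_le zero_le_one]
    have hd : ∀ t ∈ uIcc (0 : ℝ) 1,
        HasDerivAt (fun t => a ^ 2 * t + a * b * t ^ 2 + b ^ 2 / 3 * t ^ 3) ((a + b * t) ^ 2) t := by
      intro t _
      have h1 := ((hasDerivAt_id t).const_mul (a ^ 2)).add
        (((hasDerivAt_pow 2 t).const_mul (a * b)).add ((hasDerivAt_pow 3 t).const_mul (b ^ 2 / 3)))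
      refine (h1.congr_deriv ?_).congr_of_eventuallyEq (Filter.Eventually.of_forall fun s => ?_)
      · simp
        ring
      · simp
        ring
    rw [intervalIntegral.integral_eq_sub_of_hasDerivAt hd
      (Continuous.intervalIntegrable (by fun_prop) _ _)]
    ring
  nlinarith [sq_nonneg (3 * a + 2 * b)]

theorem setIntegral_segment_hausdorffMeasure [MeasurableSpace E] [BorelSpace E]
    [SecondCountableTopology E] (a b : E) (hab : a ≠ b) (f : E → ℝ) :
    ∫ z in segment ℝ a b, f z ∂μH[1]
      = dist a b * ∫ t in Icc (0 : ℝ) 1, f (AffineMap.lineMap a b t) := by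
  have hinj : Function.Injective (AffineMap.lineMap a b : ℝ → E) :=
    AffineMap.lineMap_injective ℝ hab
  have hemb : MeasurableEmbedding (AffineMap.lineMap a b : ℝ → E) :=
    AffineMap.lineMap_continuous.measurableEmbedding hinj
  have hcomap : (μH[1] : Measure E).comap (AffineMap.lineMap a b : ℝ → E)
      = nndist a b • (volume : Measure ℝ) := by
    ext s hs
    rw [hemb.comap_apply, hausdorffMeasure_lineMap_image, hausdorffMeasure_real]
    rfl
  have hseg : segment ℝ a b = (AffineMap.lineMap a b : ℝ → E) '' Icc 0 1 :=
    segment_eq_image_lineMap ℝ a b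
  have hrange : (μH[1] : Measure E).restrict (segment ℝ a b)
      = (((μH[1] : Measure E).comap (AffineMap.lineMap a b : ℝ → E)).map
        (AffineMap.lineMap a b : ℝ → E)).restrict (segment ℝ a b) := by
    rw [hemb.map_comap, Measure.restrict_restrict_of_subset]
    rw [hseg]
    exact image_subset_range _ _
  rw [hrange, hemb.setIntegral_map, hcomap, hseg, preimage_image_eq _ hinj,
    Measure.restrict_smul, integral_smul_nnreal_measure]
  rfl

/-- Taylor's formula along a segment, with the base point reached at quadratic speed. -/
theorem sub_taylor_eq_integral {U : Set E} (hU : IsOpen U) {u : E → ℝ}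
    (hu : ContDiffOn ℝ 2 u U) {x y : E}
    (hxy : ∀ τ ∈ Icc (0 : ℝ) 1, y + τ ^ 2 • (x - y) ∈ U) :
    u y - (u x + fderiv ℝ u x (y - x)) = ∫ τ in Icc (0 : ℝ) 1,
      2 * τ ^ 3 * fderiv ℝ (fderiv ℝ u) (y + τ ^ 2 • (x - y)) (x - y) (x - y) := by
  have hD : ContDiffOn ℝ 1 (fderiv ℝ u) U := hu.fderiv_of_isOpen hU (by norm_num)
  have hH : ContinuousOn (fderiv ℝ (fderiv ℝ u)) U := hD.continuousOn_fderiv_of_isOpen hU le_rfl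
  have hline : ContinuousOn (fun τ : ℝ => y + τ ^ 2 • (x - y)) (Icc 0 1) := by fun_prop
  have hHc : ContinuousOn (fun τ : ℝ => fderiv ℝ (fderiv ℝ u) (y + τ ^ 2 • (x - y))) (Icc 0 1) :=
    hH.comp hline hxy
  have hcont : ContinuousOn (fun τ : ℝ =>
      -(2 * τ ^ 3 * fderiv ℝ (fderiv ℝ u) (y + τ ^ 2 • (x - y)) (x - y) (x - y))) (Icc 0 1) :=
    (ContinuousOn.mul (by fun_prop)
      ((hHc.clm_apply continuousOn_const).clm_apply continuousOn_const)).neg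
  have hderiv : ∀ τ ∈ uIcc (0 : ℝ) 1, HasDerivAt
      (fun τ : ℝ => u (y + τ ^ 2 • (x - y))
        - fderiv ℝ u (y + τ ^ 2 • (x - y)) (τ ^ 2 • (x - y)))
      (-(2 * τ ^ 3 * fderiv ℝ (fderiv ℝ u) (y + τ ^ 2 • (x - y)) (x - y) (x - y))) τ := by
    intro τ hτ
    rw [uIcc_of_le zero_le_one] at hτ
    have hmem := hU.mem_nhds (hxy τ hτ)
    have hq : HasDerivAt (fun τ : ℝ => τ ^ 2 • (x - y)) ((2 * τ) • (x - y)) τ := by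
      simpa using (hasDerivAt_pow 2 τ).smul_const (x - y)
    have hz := hq.const_add y
    have h1 : HasDerivAt (fun τ : ℝ => u (y + τ ^ 2 • (x - y)))
        (fderiv ℝ u (y + τ ^ 2 • (x - y)) ((2 * τ) • (x - y))) τ :=
      ((hu.contDiffAt hmem).differentiableAt (by norm_num)).hasFDerivAt.comp_hasDerivAt τ hz
    have h2 : HasDerivAt (fun τ : ℝ => fderiv ℝ u (y + τ ^ 2 • (x - y)))
        (fderiv ℝ (fderiv ℝ u) (y + τ ^ 2 • (x - y)) ((2 * τ) • (x - y))) τ :=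
      ((hD.contDiffAt hmem).differentiableAt (by norm_num)).hasFDerivAt.comp_hasDerivAt τ hz
    refine (h1.sub (h2.clm_apply hq)).congr_deriv ?_
    simp only [map_smul, smul_apply, smul_eq_mul]
    ring
  rw [integral_Icc_eq_integral_Ioc, ← intervalIntegral.integral_of_le zero_le_one]
  have hInt := intervalIntegral.integral_eq_sub_of_hasDerivAt hderiv
    (ContinuousOn.intervalIntegrable (by rw [uIcc_of_le zero_le_one]; exact hcont))
  rw [intervalIntegral.integral_neg] at hInt
  simp only [one_pow, one_smul, add_sub_cancel] at hInt
  rw [← neg_sub x y, map_neg]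
  simp at hInt ⊢
  linarith

/-- Contracting a set towards one of its points by the factor `r` and weighting with the
Jacobian does not increase the integral of a nonnegative function. -/
theorem setIntegral_comp_contraction_le [MeasurableSpace E] [BorelSpace E]
    [FiniteDimensional ℝ E] {μ : Measure E} [μ.IsAddHaarMeasure]
    {T : Set E} (hT : IsCompact T) (hconv : Convex ℝ T) {F : E → ℝ} (hF : ContinuousOn F T)
    (hF0 : ∀ z, 0 ≤ F z) {y : E} (hy : y ∈ T) {r : ℝ} (hr : 0 < r) (hr1 : r ≤ 1) :
    ∫ x in T, r ^ Module.finrank ℝ E * F (y + r • (x - y)) ∂μ ≤ ∫ x in T, F x ∂μ := by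
  have hG0 : ∀ z, 0 ≤ T.indicator F z := indicator_nonneg fun z _ => hF0 z
  have hGi : Integrable (T.indicator F) μ :=
    (hF.integrableOn_compact hT).integrable_indicator hT.measurableSet
  have hpt : ∀ x : E, T.indicator F (y + r • (x - y))
      = T.indicator F (r • x + (y - r • y)) := fun x => by
    congr 1
    rw [smul_sub]
    abel
  have hGc : Integrable (fun x => T.indicator F (y + r • (x - y))) μ := by
    simp_rw [hpt]
    exact (hGi.comp_add_right (y - r • y)).comp_smul hr.ne'
  calc ∫ x in T, r ^ Module.finrank ℝ E * F (y + r • (x - y)) ∂μ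
      = ∫ x in T, r ^ Module.finrank ℝ E * T.indicator F (y + r • (x - y)) ∂μ := by
        refine setIntegral_congr_fun hT.measurableSet fun x hx => ?_
        have hmem : y + r • (x - y) ∈ T := hconv.add_smul_sub_mem hy hx ⟨hr.le, hr1⟩
        simp only [indicator_of_mem hmem]
    _ ≤ ∫ x, r ^ Module.finrank ℝ E * T.indicator F (y + r • (x - y)) ∂μ :=
        setIntegral_le_integral (hGc.const_mul _)
          (Filter.Eventually.of_forall fun x => mul_nonneg (by positivity) (hG0 _))
    _ = ∫ x in T, F x ∂μ := by
        simp_rw [hpt]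
        rw [integral_const_mul,
          Measure.integral_comp_smul_of_nonneg μ (fun x => T.indicator F (x + (y - r • y))) r
            (hR := hr.le),
          integral_add_right_eq_self, integral_indicator hT.measurableSet, smul_eq_mul,
          mul_inv_cancel_left₀ (by positivity)]

/-- An affine function that is a best `L²` approximation of `u` on a segment is, at an endpoint,
as close to any other affine function as that function is to `u` on the segment. -/
theorem sq_sub_le_of_isBestApprox_segment [MeasurableSpace E] [BorelSpace E]
    [SecondCountableTopology E] {a b : E} (hab : a ≠ b) {u : E → ℝ}
    (hu : ContinuousOn u (segment ℝ a b)) {g : E →ᵃ[ℝ] ℝ}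
    (hg : ∀ g' : E →ᵃ[ℝ] ℝ, (∫ z in segment ℝ a b, (u z - g z) ^ 2 ∂μH[1])
      ≤ ∫ z in segment ℝ a b, (u z - g' z) ^ 2 ∂μH[1]) (l : E →ᵃ[ℝ] ℝ) :
    (g a - l a) ^ 2 ≤ 16 * ∫ t in Icc (0 : ℝ) 1,
      (u (AffineMap.lineMap a b t) - l (AffineMap.lineMap a b t)) ^ 2 := by
  have hmin := hg l
  rw [setIntegral_segment_hausdorffMeasure a b hab,
    setIntegral_segment_hausdorffMeasure a b hab] at hmin
  have hmin' := le_of_mul_le_mul_left hmin (dist_pos.2 hab)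
  have hline : ContinuousOn (fun t : ℝ => u (AffineMap.lineMap a b t)) (Icc 0 1) :=
    hu.comp AffineMap.lineMap_continuous.continuousOn fun t ht => by
      rw [segment_eq_image_lineMap]
      exact mem_image_of_mem _ ht
  have happ : ∀ (f : E →ᵃ[ℝ] ℝ) (t : ℝ), f (AffineMap.lineMap a b t) = f a + (f b - f a) * t := by
    intro f t
    rw [AffineMap.apply_lineMap, AffineMap.lineMap_apply]
    simp
    ring
  have hl : ContinuousOn (fun t : ℝ => l (AffineMap.lineMap a b t)) (Icc 0 1) := by
    simp_rw [happ]
    fun_prop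
  refine sq_le_of_affine_approx (hline.sub hl) (g a - l a) ((g b - g a) - (l b - l a)) ?_
  refine le_of_eq_of_le (integral_congr_ae (Filter.Eventually.of_forall fun t => ?_)) hmin'
  simp only [Pi.sub_apply, happ]
  ring

end Analysis

section Tetrahedron

/-- The pointwise squared Frobenius norm of the Hessian, the integrand of `H2seminorm`. -/
def hessianNormSq (u : EuclideanSpace ℝ (Fin 3) → ℝ) (z : EuclideanSpace ℝ (Fin 3)) : ℝ :=
  ∑ i : Fin 3, ∑ j : Fin 3, (iteratedFDeriv ℝ 2 u z
    ![EuclideanSpace.single i 1, EuclideanSpace.single j 1]) ^ 2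

variable {u : EuclideanSpace ℝ (Fin 3) → ℝ} {U T : Set (EuclideanSpace ℝ (Fin 3))}

theorem hessianNormSq_nonneg (u : EuclideanSpace ℝ (Fin 3) → ℝ) (z : EuclideanSpace ℝ (Fin 3)) :
    0 ≤ hessianNormSq u z :=
  Finset.sum_nonneg fun _ _ => Finset.sum_nonneg fun _ _ => sq_nonneg _

theorem continuousOn_iteratedFDeriv_two_apply (hU : IsOpen U) (hu : ContDiffOn ℝ 2 u U)
    (v : Fin 2 → EuclideanSpace ℝ (Fin 3)) :
    ContinuousOn (fun z => iteratedFDeriv ℝ 2 u z v) U := by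
  simp_rw [iteratedFDeriv_two_apply]
  have hD : ContDiffOn ℝ 1 (fderiv ℝ u) U := hu.fderiv_of_isOpen hU (by norm_num)
  exact ((hD.continuousOn_fderiv_of_isOpen hU le_rfl).clm_apply continuousOn_const).clm_apply
    continuousOn_const

theorem continuousOn_hessianNormSq (hU : IsOpen U) (hu : ContDiffOn ℝ 2 u U) :
    ContinuousOn (hessianNormSq u) U :=
  continuousOn_finsetSum _ fun _ _ => continuousOn_finsetSum _ fun _ _ =>
    (continuousOn_iteratedFDeriv_two_apply hU hu _).pow 2

theorem H2seminorm_eq_sqrt_integral (hU : IsOpen U) (hu : ContDiffOn ℝ 2 u U)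
    (hT : IsCompact T) (hTU : T ⊆ U) :
    H2seminorm T u = Real.sqrt (∫ x in T, hessianNormSq u x) := by
  have hi : ∀ i j : Fin 3, IntegrableOn (fun x => (iteratedFDeriv ℝ 2 u x
      ![EuclideanSpace.single i 1, EuclideanSpace.single j 1]) ^ 2) T := fun i j =>
    (((continuousOn_iteratedFDeriv_two_apply hU hu _).mono hTU).pow 2).integrableOn_compact hT
  unfold H2seminorm hessianNormSq
  rw [integral_finsetSum _ fun i _ => integrable_finsetSum _ fun j _ => hi i j]
  congr 1
  refine Finset.sum_congr rfl fun i _ => ?_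
  rw [integral_finsetSum _ fun j _ => hi i j]

theorem sq_fderiv_fderiv_apply_le (u : EuclideanSpace ℝ (Fin 3) → ℝ)
    (z v : EuclideanSpace ℝ (Fin 3)) :
    (fderiv ℝ (fderiv ℝ u) z v v) ^ 2 ≤ hessianNormSq u z * ‖v‖ ^ 4 := by
  have hv : v = ∑ i : Fin 3, v i • EuclideanSpace.single i (1 : ℝ) := by
    ext k
    simp [Pi.single_apply]
  have hexp : fderiv ℝ (fderiv ℝ u) z v v = ∑ q : Fin 3 × Fin 3, iteratedFDeriv ℝ 2 u z
      ![EuclideanSpace.single q.1 1, EuclideanSpace.single q.2 1] * (v q.1 * v q.2) := by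
    simp_rw [iteratedFDeriv_two_apply]
    rw [Fintype.sum_prod_type]
    conv_lhs => rw [hv]
    simp only [map_sum, map_smul, sum_apply, smul_apply,
      smul_eq_mul, Matrix.cons_val_zero, Matrix.cons_val_one, Finset.mul_sum]
    refine Finset.sum_comm.trans (Finset.sum_congr rfl fun i _ => Finset.sum_congr rfl fun j _ => ?_)
    ring
  have hnorm : ∑ q : Fin 3 × Fin 3, (v q.1 * v q.2) ^ 2 = ‖v‖ ^ 4 := by
    have : ‖v‖ ^ 4 = (‖v‖ ^ 2) * (‖v‖ ^ 2) := by ring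
    rw [this, EuclideanSpace.real_norm_sq_eq, Finset.sum_mul_sum, Fintype.sum_prod_type]
    simp_rw [mul_pow]
  rw [hexp, ← hnorm]
  refine (Finset.sum_mul_sq_le_sq_mul_sq _ _ _).trans_eq ?_
  rw [hessianNormSq, Fintype.sum_prod_type]

theorem integral_sq_taylor_remainder_le (hU : IsOpen U) (hu : ContDiffOn ℝ 2 u U)
    (hT : IsCompact T) (hconv : Convex ℝ T) (hTU : T ⊆ U) {y : EuclideanSpace ℝ (Fin 3)}
    (hy : y ∈ T) :
    ∫ x in T, (u y - (u x + fderiv ℝ u x (y - x))) ^ 2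
      ≤ 4 * Metric.diam T ^ 4 * ∫ x in T, hessianNormSq u x := by
  set G : EuclideanSpace ℝ (Fin 3) × ℝ → ℝ := fun q =>
    (q.2 ^ 2) ^ 3 * hessianNormSq u (y + q.2 ^ 2 • (q.1 - y)) with hG
  have hmem : ∀ x ∈ T, ∀ τ ∈ Icc (0 : ℝ) 1, y + τ ^ 2 • (x - y) ∈ T := fun x hx τ hτ =>
    hconv.add_smul_sub_mem hy hx ⟨by positivity, pow_le_one₀ hτ.1 hτ.2⟩
  have hN : ContinuousOn (hessianNormSq u) T := (continuousOn_hessianNormSq hU hu).mono hTU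
  have hGc : ContinuousOn G (T ×ˢ Icc 0 1) := by
    have hpath : ContinuousOn (fun q : EuclideanSpace ℝ (Fin 3) × ℝ => y + q.2 ^ 2 • (q.1 - y))
        (T ×ˢ Icc 0 1) := by fun_prop
    exact ContinuousOn.mul (by fun_prop) (hN.comp hpath fun q hq => hmem q.1 hq.1 q.2 hq.2)
  have hGi := integrable_prod_of_continuousOn (μ := volume) hT hGc
  have hGx : ∀ x ∈ T, ContinuousOn (fun τ => G (x, τ)) (Icc 0 1) := fun x hx =>
    hGc.comp (by fun_prop) fun τ hτ => ⟨hx, hτ⟩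
  have hpoint : ∀ x ∈ T, (u y - (u x + fderiv ℝ u x (y - x))) ^ 2
      ≤ 4 * Metric.diam T ^ 4 * ∫ τ in Icc (0 : ℝ) 1, G (x, τ) := by
    intro x hx
    have hH : ContinuousOn (fun τ : ℝ => 2 * τ ^ 3 *
        fderiv ℝ (fderiv ℝ u) (y + τ ^ 2 • (x - y)) (x - y) (x - y)) (Icc 0 1) := by
      have := (continuousOn_iteratedFDeriv_two_apply hU hu ![x - y, x - y]).comp
        (f := fun τ : ℝ => y + τ ^ 2 • (x - y)) (s := Icc (0 : ℝ) 1) (by fun_prop)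
        fun τ hτ => hTU (hmem x hx τ hτ)
      simp only [Function.comp_def, iteratedFDeriv_two_apply, Matrix.cons_val_zero,
        Matrix.cons_val_one] at this
      exact ContinuousOn.mul (by fun_prop) this
    rw [sub_taylor_eq_integral hU hu fun τ hτ => hTU (hmem x hx τ hτ)]
    refine (sq_integral_Icc_le hH).trans ?_
    rw [← integral_const_mul]
    refine setIntegral_mono_on ((hH.pow 2).integrableOn_compact isCompact_Icc)
      ((continuousOn_const.mul (hGx x hx)).integrableOn_compact isCompact_Icc)
      measurableSet_Icc fun τ hτ => ?_
    have hdist : ‖x - y‖ ^ 4 ≤ Metric.diam T ^ 4 := by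
      rw [← dist_eq_norm]
      gcongr
      exact Metric.dist_le_diam_of_mem hT.isBounded hx hy
    have hle := (sq_fderiv_fderiv_apply_le u (y + τ ^ 2 • (x - y)) (x - y)).trans
      (mul_le_mul_of_nonneg_left hdist (hessianNormSq_nonneg u _))
    calc _ = 4 * (τ ^ 2) ^ 3 *
          (fderiv ℝ (fderiv ℝ u) (y + τ ^ 2 • (x - y)) (x - y) (x - y)) ^ 2 := by ring
      _ ≤ 4 * (τ ^ 2) ^ 3 * (hessianNormSq u (y + τ ^ 2 • (x - y)) * Metric.diam T ^ 4) := by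
        gcongr
      _ = _ := by
        rw [hG]
        ring
  calc ∫ x in T, (u y - (u x + fderiv ℝ u x (y - x))) ^ 2
      ≤ ∫ x in T, 4 * Metric.diam T ^ 4 * ∫ τ in Icc (0 : ℝ) 1, G (x, τ) :=
        integral_mono_of_nonneg (Filter.Eventually.of_forall fun x => sq_nonneg _)
          (hGi.integral_prod_left.const_mul _)
          ((ae_restrict_mem hT.measurableSet).mono hpoint)
    _ = 4 * Metric.diam T ^ 4 * ∫ τ in Icc (0 : ℝ) 1, ∫ x in T, G (x, τ) := by
        rw [integral_const_mul, integral_integral_swap hGi]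
    _ ≤ 4 * Metric.diam T ^ 4 * ∫ τ in Icc (0 : ℝ) 1, ∫ x in T, hessianNormSq u x := by
        refine mul_le_mul_of_nonneg_left ?_ (by positivity)
        refine setIntegral_mono_on hGi.integral_prod_right (by simp) measurableSet_Icc
          fun τ hτ => ?_
        rcases hτ.1.eq_or_lt with rfl | hτ0
        · simpa [hG] using integral_nonneg fun x => hessianNormSq_nonneg u x
        · simpa [hG] using setIntegral_comp_contraction_le (μ := volume) hT hconv hN
            (hessianNormSq_nonneg u) hy (pow_pos hτ0 2) (pow_le_one₀ hτ.1 hτ.2)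
    _ = 4 * Metric.diam T ^ 4 * ∫ x in T, hessianNormSq u x := by simp

theorem radius_le_of_closedBall_subset {c : EuclideanSpace ℝ (Fin 3)} {s : ℝ}
    (f : EuclideanSpace ℝ (Fin 3) →ᵃ[ℝ] ℝ) (hf : ∀ z ∈ T, f z ∈ Icc (0 : ℝ) 1)
    (hs : Metric.closedBall c s ⊆ T) (k : Fin 3) :
    |f.linear (EuclideanSpace.single k 1)| * s ≤ 1 := by
  rcases le_or_gt s 0 with hs0 | hs0
  · exact (mul_nonpos_of_nonneg_of_nonpos (abs_nonneg _) hs0).trans zero_le_one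
  have h1 := hf c (hs (Metric.mem_closedBall_self hs0.le))
  have h2 := hf (s • EuclideanSpace.single k (1 : ℝ) +ᵥ c) (hs (by
    simp [norm_smul, abs_of_pos hs0]))
  rw [f.map_vadd, map_smul, vadd_eq_add, smul_eq_mul] at h2
  calc |f.linear (EuclideanSpace.single k 1)| * s
      = |s * f.linear (EuclideanSpace.single k 1)| := by rw [abs_mul, abs_of_pos hs0, mul_comm]
    _ ≤ 1 := abs_le.2 ⟨by linarith [h1.2, h2.1], by linarith [h1.1, h2.2]⟩

theorem abs_linear_mul_inradius_le (f : EuclideanSpace ℝ (Fin 3) →ᵃ[ℝ] ℝ)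
    (hf : ∀ z ∈ T, f z ∈ Icc (0 : ℝ) 1) (k : Fin 3) :
    |f.linear (EuclideanSpace.single k 1)| * inradius T ≤ 1 := by
  rcases (abs_nonneg (f.linear (EuclideanSpace.single k 1))).eq_or_lt with h0 | h0
  · rw [← h0, zero_mul]
    exact zero_le_one
  rw [← le_div_iff₀' h0]
  refine csSup_le ⟨-1, 0, by simp⟩ ?_
  rintro s ⟨c, hs⟩
  rw [le_div_iff₀' h0]
  exact radius_le_of_closedBall_subset f hf hs k

theorem inradius_pos (hT : Bornology.IsBounded T) (hInt : (interior T).Nonempty) :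
    0 < inradius T := by
  obtain ⟨c, hc⟩ := hInt
  obtain ⟨s, hs, hball⟩ := Metric.nhds_basis_closedBall.mem_iff.1 (mem_interior_iff_mem_nhds.1 hc)
  refine hs.trans_le (le_csSup ⟨Metric.diam T, ?_⟩ ⟨c, hball⟩)
  rintro s ⟨c, hs⟩
  rcases le_or_gt s 0 with hs0 | hs0
  · exact hs0.trans Metric.diam_nonneg
  have h := Metric.dist_le_diam_of_mem hT
    (x := s • EuclideanSpace.single (0 : Fin 3) (1 : ℝ) +ᵥ c) (y := c)
    (hs (by simp [norm_smul, abs_of_pos hs0])) (hs (Metric.mem_closedBall_self hs0.le))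
  simpa [norm_smul, abs_of_pos hs0] using h

/-- The first-order Taylor polynomial of `u` at `x`. -/
def taylorAffine (u : EuclideanSpace ℝ (Fin 3) → ℝ) (x : EuclideanSpace ℝ (Fin 3)) :
    EuclideanSpace ℝ (Fin 3) →ᵃ[ℝ] ℝ :=
  (fderiv ℝ u x).toLinearMap.toAffineMap + AffineMap.const ℝ _ (u x - fderiv ℝ u x x)

theorem taylorAffine_apply (u : EuclideanSpace ℝ (Fin 3) → ℝ) (x y : EuclideanSpace ℝ (Fin 3)) :
    taylorAffine u x y = u x + fderiv ℝ u x (y - x) := by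
  simp [taylorAffine]
  ring

theorem taylorAffine_linear (u : EuclideanSpace ℝ (Fin 3) → ℝ) (x : EuclideanSpace ℝ (Fin 3)) :
    (taylorAffine u x).linear = (fderiv ℝ u x).toLinearMap := by
  simp [taylorAffine]

variable {p : Fin 4 → EuclideanSpace ℝ (Fin 3)}
  {lam : Fin 4 → (EuclideanSpace ℝ (Fin 3) →ᵃ[ℝ] ℝ)}

theorem affineSpan_range_eq_top (hp : AffineIndependent ℝ p) : affineSpan ℝ (range p) = ⊤ :=
  hp.affineSpan_eq_top_iff_card_eq_finrank_add_one.2 (by simp)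

theorem barycentric_mem_Icc (hlam : ∀ i j, lam i (p j) = if i = j then 1 else 0) (i : Fin 4) :
    ∀ z ∈ convexHull ℝ (range p), lam i z ∈ Icc (0 : ℝ) 1 := by
  refine convexHull_min ?_ ((convex_Icc (0 : ℝ) 1).affine_preimage (lam i))
  rintro _ ⟨j, rfl⟩
  change lam i (p j) ∈ Icc (0 : ℝ) 1
  rw [hlam]
  split_ifs <;> simp

/-- Affine functions are reproduced by linear interpolation at the vertices. -/
theorem sum_apply_smul_barycentric (hp : AffineIndependent ℝ p)
    (hlam : ∀ i j, lam i (p j) = if i = j then 1 else 0)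
    (l : EuclideanSpace ℝ (Fin 3) →ᵃ[ℝ] ℝ) : ∑ i, l (p i) • lam i = l := by
  refine AffineMap.ext_on (affineSpan_range_eq_top hp) ?_
  rintro _ ⟨j, rfl⟩
  fin_cases j <;> simp [Fin.sum_univ_four, hlam]

theorem fderiv_sub_sum_barycentric (hp : AffineIndependent ℝ p)
    (hlam : ∀ i j, lam i (p j) = if i = j then 1 else 0) {x : EuclideanSpace ℝ (Fin 3)}
    (hu : DifferentiableAt ℝ u x) (c : Fin 4 → ℝ) (v : EuclideanSpace ℝ (Fin 3)) :
    fderiv ℝ (fun x => u x - ∑ i, c i * lam i x) x v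
      = ∑ i, (taylorAffine u x (p i) - c i) * (lam i).linear v := by
  have hd : ∀ i, HasFDerivAt (lam i) (LinearMap.toContinuousLinearMap (lam i).linear) x := by
    intro i
    have : ⇑(lam i) = fun y => LinearMap.toContinuousLinearMap (lam i).linear y + lam i 0 := by
      rw [AffineMap.decomp (lam i)]
      ext y
      simp
    rw [this]
    exact (ContinuousLinearMap.hasFDerivAt _).add_const _
  have hsum := HasFDerivAt.fun_sum (u := Finset.univ) fun i _ => (hd i).const_mul (c i)
  have hrep := congrArg (fun l : EuclideanSpace ℝ (Fin 3) →ᵃ[ℝ] ℝ => l.linear v)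
    (sum_apply_smul_barycentric hp hlam (taylorAffine u x))
  simp only [taylorAffine_linear, Fin.sum_univ_four, AffineMap.add_linear, AffineMap.smul_linear,
    LinearMap.add_apply, LinearMap.smul_apply, smul_eq_mul, ContinuousLinearMap.coe_coe] at hrep
  have hfd : fderiv ℝ (fun x => u x - ∑ i, c i * lam i x) x = _ := (hu.hasFDerivAt.sub hsum).fderiv
  rw [hfd]
  simp only [Fin.sum_univ_four, sub_apply, add_apply, smul_apply,
    LinearMap.coe_toContinuousLinearMap', smul_eq_mul, ← hrep]
  ring

/-- The Taylor remainder averaged over a segment is integrable in the base point, with integral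
controlled by the Hessian. -/
theorem integral_segment_taylor_remainder_le (hU : IsOpen U) (hu : ContDiffOn ℝ 2 u U)
    (hT : IsCompact T) (hconv : Convex ℝ T) (hTU : T ⊆ U) {a b : EuclideanSpace ℝ (Fin 3)}
    (ha : a ∈ T) (hb : b ∈ T) :
    IntegrableOn (fun x => ∫ t in Icc (0 : ℝ) 1,
      (u (AffineMap.lineMap a b t) - taylorAffine u x (AffineMap.lineMap a b t)) ^ 2) T ∧
    ∫ x in T, ∫ t in Icc (0 : ℝ) 1,
      (u (AffineMap.lineMap a b t) - taylorAffine u x (AffineMap.lineMap a b t)) ^ 2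
        ≤ 4 * Metric.diam T ^ 4 * ∫ x in T, hessianNormSq u x := by
  have hmem : ∀ t ∈ Icc (0 : ℝ) 1, AffineMap.lineMap a b t ∈ T := fun t ht =>
    hconv.lineMap_mem ha hb ht
  have huT : ContinuousOn u T := hu.continuousOn.mono hTU
  have hDT : ContinuousOn (fderiv ℝ u) T :=
    (hu.continuousOn_fderiv_of_isOpen hU (by norm_num)).mono hTU
  have hline : Continuous (fun q : EuclideanSpace ℝ (Fin 3) × ℝ =>
      (AffineMap.lineMap a b q.2 : EuclideanSpace ℝ (Fin 3))) :=
    AffineMap.lineMap_continuous.comp continuous_snd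
  have hcont : ContinuousOn (fun q : EuclideanSpace ℝ (Fin 3) × ℝ =>
      (u (AffineMap.lineMap a b q.2) - taylorAffine u q.1 (AffineMap.lineMap a b q.2)) ^ 2)
      (T ×ˢ Icc 0 1) := by
    simp_rw [taylorAffine_apply]
    have h1 := huT.comp hline.continuousOn (s := T ×ˢ Icc (0 : ℝ) 1) fun q hq => hmem q.2 hq.2
    have h2 := huT.comp continuousOn_fst (s := T ×ˢ Icc (0 : ℝ) 1) fun q hq => hq.1
    have h3 := hDT.comp continuousOn_fst (s := T ×ˢ Icc (0 : ℝ) 1) fun q hq => hq.1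
    exact (h1.sub (h2.add (h3.clm_apply (hline.sub continuous_fst).continuousOn))).pow 2
  have hInt := integrable_prod_of_continuousOn (μ := volume) hT hcont
  refine ⟨hInt.integral_prod_left, ?_⟩
  rw [integral_integral_swap hInt]
  calc ∫ t in Icc (0 : ℝ) 1, ∫ x in T,
        (u (AffineMap.lineMap a b t) - taylorAffine u x (AffineMap.lineMap a b t)) ^ 2
      ≤ ∫ t in Icc (0 : ℝ) 1, 4 * Metric.diam T ^ 4 * ∫ x in T, hessianNormSq u x := by
        refine setIntegral_mono_on hInt.integral_prod_right (integrable_const _) measurableSet_Icc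
          fun t ht => ?_
        simp_rw [taylorAffine_apply]
        exact integral_sq_taylor_remainder_le hU hu hT hconv hTU (hmem t ht)
    _ = 4 * Metric.diam T ^ 4 * ∫ x in T, hessianNormSq u x := by simp

theorem sq_sum_four_mul_le (a b : Fin 4 → ℝ) {B : ℝ} (hb : ∀ i, |b i| ≤ B) :
    (∑ i, a i * b i) ^ 2 ≤ 4 * B ^ 2 * ∑ i, a i ^ 2 := by
  calc (∑ i, a i * b i) ^ 2 ≤ (∑ i, a i ^ 2) * ∑ i, b i ^ 2 := Finset.sum_mul_sq_le_sq_mul_sq _ _ _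
    _ ≤ (∑ i, a i ^ 2) * ∑ _i : Fin 4, B ^ 2 := by
        refine mul_le_mul_of_nonneg_left (Finset.sum_le_sum fun i _ => ?_)
          (Finset.sum_nonneg fun i _ => sq_nonneg _)
        exact sq_le_sq.2 ((hb i).trans (le_abs_self B))
    _ = 4 * B ^ 2 * ∑ i, a i ^ 2 := by
        simp
        ring

end Tetrahedron

/-- First-order local interpolation error estimate for the
quasi-interpolant `Du = Σᵢ (Π_{σᵢ}u)(pᵢ) λᵢ` on a shape-regular tetrahedron
(`h/r ≤ ρ`, `h` the diameter, `r` the inradius), with edges `σᵢ` of `T` emanating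
from the vertices `pᵢ`: `|u − Du|_{H¹(T)} ≤ C h |u|_{H²(T)}`, where `C` depends
only on `ρ`. -/
theorem quasi_interpolant_H1_error_estimate :
    ∀ ρ : ℝ, 1 ≤ ρ →
    ∃ C : ℝ, 0 < C ∧
      ∀ p : Fin 4 → EuclideanSpace ℝ (Fin 3), AffineIndependent ℝ p →
      ∀ T : Set (EuclideanSpace ℝ (Fin 3)), T = convexHull ℝ (range p) →
      Metric.diam T / inradius T ≤ ρ →
      ∀ e : Fin 4 → Fin 4, (∀ i, e i ≠ i) →
      ∀ lam : Fin 4 → (EuclideanSpace ℝ (Fin 3) →ᵃ[ℝ] ℝ),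
        (∀ i j, lam i (p j) = if i = j then 1 else 0) →
      ∀ u : EuclideanSpace ℝ (Fin 3) → ℝ,
        (∃ U : Set (EuclideanSpace ℝ (Fin 3)), IsOpen U ∧ closure T ⊆ U ∧
          ContDiffOn ℝ 2 u U) →
      ∀ g : Fin 4 → (EuclideanSpace ℝ (Fin 3) →ᵃ[ℝ] ℝ),
        (∀ i, ∀ g' : EuclideanSpace ℝ (Fin 3) →ᵃ[ℝ] ℝ,
          (∫ x in segment ℝ (p i) (p (e i)), (u x - g i x) ^ 2 ∂μH[1]) ≤
            ∫ x in segment ℝ (p i) (p (e i)), (u x - g' x) ^ 2 ∂μH[1]) →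
      H1seminorm T (fun x => u x - ∑ i : Fin 4, g i (p i) * lam i x) ≤
        C * Metric.diam T * H2seminorm T u := by
  intro ρ hρ
  refine ⟨56 * ρ, by positivity, ?_⟩
  intro p hp T hTeq hshape e he lam hlam u ⟨U, hU, hclU, hu⟩ g hg
  have hTU : T ⊆ U := subset_closure.trans hclU
  have hconv : Convex ℝ T := hTeq ▸ convex_convexHull ℝ _
  have hT : IsCompact T := hTeq ▸ (finite_range p).isCompact_convexHull ℝ
  have hpT : ∀ i, p i ∈ T := fun i => hTeq ▸ subset_convexHull ℝ _ (mem_range_self i)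
  have hr : 0 < inradius T := by
    refine inradius_pos hT.isBounded ?_
    rw [hTeq, interior_convexHull_nonempty_iff_affineSpan_eq_top]
    exact affineSpan_range_eq_top hp
  have hdiam : Metric.diam T ≤ ρ * inradius T := (div_le_iff₀ hr).1 hshape
  have hgrad : ∀ k i, |(lam i).linear (EuclideanSpace.single k 1)| ≤ 1 / inradius T :=
    fun k i => (le_div_iff₀ hr).2 (abs_linear_mul_inradius_le (lam i)
      (fun z hz => barycentric_mem_Icc hlam i z (hTeq ▸ hz)) k)
  set N := ∫ x in T, hessianNormSq u x with hN
  have hN0 : 0 ≤ N := integral_nonneg fun x => hessianNormSq_nonneg u x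
  set J : Fin 4 → EuclideanSpace ℝ (Fin 3) → ℝ := fun i x => ∫ t in Icc (0 : ℝ) 1,
    (u (AffineMap.lineMap (p i) (p (e i)) t)
      - taylorAffine u x (AffineMap.lineMap (p i) (p (e i)) t)) ^ 2 with hJ
  have hJi : ∀ i, IntegrableOn (J i) T ∧ ∫ x in T, J i x ≤ 4 * Metric.diam T ^ 4 * N := fun i =>
    integral_segment_taylor_remainder_le hU hu hT hconv hTU (hpT i) (hpT (e i))
  have hnode : ∀ i x, (taylorAffine u x (p i) - g i (p i)) ^ 2 ≤ 16 * J i x := by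
    intro i x
    rw [← neg_sub, neg_sq]
    exact sq_sub_le_of_isBestApprox_segment (fun h => he i (hp.injective h).symm)
      (hu.continuousOn.mono ((hconv.segment_subset (hpT i) (hpT (e i))).trans hTU)) (hg i) _
  have hpoint : ∀ k, ∀ x ∈ T,
      (fderiv ℝ (fun x => u x - ∑ i, g i (p i) * lam i x) x (EuclideanSpace.single k 1)) ^ 2
        ≤ 64 * (1 / inradius T) ^ 2 * ∑ i, J i x := by
    intro k x hx
    rw [fderiv_sub_sum_barycentric hp hlam
      ((hu.contDiffAt (hU.mem_nhds (hTU hx))).differentiableAt (by norm_num))]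
    calc _ ≤ 4 * (1 / inradius T) ^ 2 * ∑ i, (taylorAffine u x (p i) - g i (p i)) ^ 2 :=
          sq_sum_four_mul_le _ _ (hgrad k)
      _ ≤ 4 * (1 / inradius T) ^ 2 * ∑ i, 16 * J i x := by
          gcongr with i
          exact hnode i x
      _ = _ := by
          rw [← Finset.mul_sum]
          ring
  have hInt : ∀ k : Fin 3, ∫ x in T,
      (fderiv ℝ (fun x => u x - ∑ i, g i (p i) * lam i x) x (EuclideanSpace.single k 1)) ^ 2
        ≤ 1024 * (1 / inradius T) ^ 2 * Metric.diam T ^ 4 * N := by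
    intro k
    calc _ ≤ ∫ x in T, 64 * (1 / inradius T) ^ 2 * ∑ i, J i x :=
          integral_mono_of_nonneg (Filter.Eventually.of_forall fun x => sq_nonneg _)
            ((integrable_finsetSum _ fun i _ => (hJi i).1).const_mul _)
            ((ae_restrict_mem hT.measurableSet).mono (hpoint k))
      _ = 64 * (1 / inradius T) ^ 2 * ∑ i, ∫ x in T, J i x := by
          rw [integral_const_mul, integral_finsetSum _ fun i _ => (hJi i).1]
      _ ≤ 64 * (1 / inradius T) ^ 2 * ∑ _i : Fin 4, 4 * Metric.diam T ^ 4 * N := by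
          gcongr with i
          exact (hJi i).2
      _ = _ := by
          simp
          ring
  have hd0 : 0 ≤ Metric.diam T := Metric.diam_nonneg
  rw [H2seminorm_eq_sqrt_integral hU hu hT hTU, H1seminorm]
  refine Real.sqrt_le_iff.2 ⟨by positivity, ?_⟩
  rw [mul_pow, Real.sq_sqrt hN0]
  have hratio : (1 / inradius T) ^ 2 * Metric.diam T ^ 4 ≤ ρ ^ 2 * Metric.diam T ^ 2 := by
    have : (Metric.diam T / inradius T) ^ 2 ≤ ρ ^ 2 := by gcongr
    calc _ = (Metric.diam T / inradius T) ^ 2 * Metric.diam T ^ 2 := by ring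
      _ ≤ _ := by gcongr
  calc _ ≤ ∑ _k : Fin 3, 1024 * (1 / inradius T) ^ 2 * Metric.diam T ^ 4 * N :=
        Finset.sum_le_sum fun k _ => hInt k
    _ = 3072 * ((1 / inradius T) ^ 2 * Metric.diam T ^ 4) * N := by
        simp
        ring
    _ ≤ 3136 * (ρ ^ 2 * Metric.diam T ^ 2) * N := by
        gcongr
        norm_num
    _ = _ := by ring
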